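/- For every p ∈ (0,1], the infimum of ψ_p over (0,∞) equals B(p), where B(p) = 4/3 if 0 < p ≤ 1/4; B(p) = (1 + p + √(p(2+p)))/(1 − p + √(p(2+p))) if 1/4 ≤ p ≤ p̄₁; and B(p) = 1 + p + p²/(1+p) if p̄₁ ≤ p ≤ 1, where p̄₁ is the unique real root of 8p³ + 4p² = 1 (so the three cases are equivalently p ≤ 1/4, 1/4 ≤ p with 8p³+4p² ≤ 1, and 8p³+4p² ≥ 1). -/

import Mathlib

/-- `ψ_p^{k,m}(y) = y·[(k(1 + p·m) − m(1 − p + p·m)) / (k(1 − p + p·k))]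
                    + (1 + p·m)/(1 − p + p·k)`. -/
noncomputable def psiKM (p : ℝ) (k m : ℕ) (y : ℝ) : ℝ :=
  y * (((k : ℝ) * (1 + p * (m : ℝ)) - (m : ℝ) * (1 - p + p * (m : ℝ)))
        / ((k : ℝ) * (1 - p + p * (k : ℝ))))
    + (1 + p * (m : ℝ)) / (1 - p + p * (k : ℝ))

/-- `ψ_p(y) = sup { ψ_p^{k,m}(y) : k, m ∈ ℕ, k ≥ 1 }`. -/
noncomputable def psiSup (p y : ℝ) : ℝ :=
  ⨆ km : ℕ × ℕ, psiKM p (km.1 + 1) km.2 y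

/-- Clearing denominators in `psiKM p k m y ≤ S`. -/
theorem psiKM_le_iff {p : ℝ} (hp0 : 0 < p) {k : ℕ} (hk : 1 ≤ k) (m : ℕ) (y S : ℝ) :
    psiKM p k m y ≤ S ↔
      0 ≤ S * (k * (1 - p + p * k)) - (1 + y) * (k * (1 + p * m)) + y * (m * (1 - p + p * m)) := by
  have hk' : (1 : ℝ) ≤ k := by exact_mod_cast hk
  have hd : 0 < 1 - p + p * (k : ℝ) := by nlinarith
  have hk0 : (0 : ℝ) < k := by linarith
  have hpsi : psiKM p k m y =
      ((1 + y) * (k * (1 + p * m)) - y * (m * (1 - p + p * m))) / (k * (1 - p + p * k)) := by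
    unfold psiKM
    field_simp
    ring
  rw [hpsi, div_le_iff₀ (by positivity)]
  constructor <;> intro h <;> linarith

theorem bddAbove_range_psiKM {p y : ℝ} (hp0 : 0 < p) (hp1 : p ≤ 1) (hy : 0 < y) :
    BddAbove (Set.range fun km : ℕ × ℕ => psiKM p (km.1 + 1) km.2 y) := by
  refine ⟨(1 + y) ^ 2 / (4 * y) + (1 + y) / p, ?_⟩
  rintro _ ⟨⟨k, m⟩, rfl⟩
  refine (psiKM_le_iff hp0 (Nat.le_add_left 1 k) m y _).2 ?_
  have hk : (1 : ℝ) ≤ ((k + 1 : ℕ) : ℝ) := by exact_mod_cast Nat.le_add_left 1 k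
  have hm : (0 : ℝ) ≤ m := Nat.cast_nonneg m
  generalize ((k + 1 : ℕ) : ℝ) = K at *
  generalize (m : ℝ) = M at *
  have hid : ((1 + y) ^ 2 / (4 * y) + (1 + y) / p) * (K * (1 - p + p * K))
      - (1 + y) * (K * (1 + p * M)) + y * (M * (1 - p + p * M))
      = p * (2 * y * M - (1 + y) * K) ^ 2 / (4 * y) + (1 + y) * (K * (K - 1))
        + ((1 + y) ^ 2 / (4 * y) + (1 + y) / p) * (K * (1 - p)) + y * (M * (1 - p)) := by
    field_simp
    ring
  rw [hid]
  have h1 : 0 ≤ 1 - p := by linarith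
  have h2 : 0 ≤ K - 1 := by linarith
  have h3 : 0 ≤ K := by linarith
  positivity

theorem sInf_psiSup_eq {p B y₀ : ℝ} (hp0 : 0 < p) (hp1 : p ≤ 1) (hy₀ : 0 < y₀)
    (upper : ∀ k m : ℕ, 1 ≤ k → psiKM p k m y₀ ≤ B)
    (lower : ∀ y S : ℝ, 0 < y → (∀ k m : ℕ, 1 ≤ k → psiKM p k m y ≤ S) → B ≤ S) :
    sInf (psiSup p '' Set.Ioi 0) = B := by
  have hlow : ∀ y, 0 < y → B ≤ psiSup p y := fun y hy => by
    refine lower y _ hy fun k m hk => ?_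
    obtain ⟨j, rfl⟩ := Nat.exists_eq_add_of_le' hk
    exact le_ciSup (bddAbove_range_psiKM hp0 hp1 hy) (j, m)
  have heq : psiSup p y₀ = B :=
    le_antisymm (ciSup_le fun km => upper _ _ (Nat.le_add_left 1 _)) (hlow y₀ hy₀)
  refine IsLeast.csInf_eq ⟨⟨y₀, hy₀, heq⟩, ?_⟩
  rintro _ ⟨y, hy, rfl⟩
  exact hlow y hy

/-- The supremum over `k, m` is at least the limiting value along `m ≈ (1 + y) k / (2 y)`. -/
theorem envelope_le_of_psiKM_le {p y S : ℝ} (hp0 : 0 < p) (hp1 : p ≤ 1) (hy : 0 < y)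
    (h : ∀ k m : ℕ, 1 ≤ k → psiKM p k m y ≤ S) : (1 + y) ^ 2 / (4 * y) ≤ S := by
  by_contra! hS
  obtain ⟨c, hc⟩ : ∃ c, c = (1 + y) / (2 * y) := ⟨_, rfl⟩
  have hc0 : 0 < c := by rw [hc]; positivity
  have hyc : 1 + y = 2 * y * c := by rw [hc]; field_simp
  have henv : (1 + y) ^ 2 / (4 * y) = y * c ^ 2 := by rw [hyc]; field_simp; ring
  rw [henv] at hS
  have hδ : 0 < p * (y * c ^ 2 - S) := mul_pos hp0 (by linarith)
  set A := |S * (1 - p) - (1 + y) + y * (1 - p) * c|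
  obtain ⟨n, hn⟩ := exists_nat_gt ((p * y + A) / (p * (y * c ^ 2 - S)))
  rw [div_lt_iff₀ hδ] at hn
  have hkey := (psiKM_le_iff hp0 (Nat.le_add_left 1 n) ⌊c * ((n + 1 : ℕ) : ℝ)⌋₊ y S).1
    (h _ _ (Nat.le_add_left 1 n))
  have hm1 := Nat.floor_le (a := c * ((n + 1 : ℕ) : ℝ)) (by positivity)
  have hm2 := Nat.lt_floor_add_one (c * ((n + 1 : ℕ) : ℝ))
  have hk : ((n + 1 : ℕ) : ℝ) = n + 1 := by push_cast; ring
  have hK : (1 : ℝ) ≤ ((n + 1 : ℕ) : ℝ) := by exact_mod_cast Nat.le_add_left 1 n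
  generalize (⌊c * ((n + 1 : ℕ) : ℝ)⌋₊ : ℝ) = M at *
  generalize ((n + 1 : ℕ) : ℝ) = K at *
  have hid : S * (K * (1 - p + p * K)) - (1 + y) * (K * (1 + p * M)) + y * (M * (1 - p + p * M))
      = p * y * (c * K - M) ^ 2 + K * (S * (1 - p) - (1 + y) + y * (1 - p) * c)
        - y * (1 - p) * (c * K - M) - p * (y * c ^ 2 - S) * K ^ 2 := by
    rw [hyc]
    ring
  rw [hid] at hkey
  have h1 : p * y * (c * K - M) ^ 2 ≤ p * y * K := by
    have : (c * K - M) ^ 2 ≤ K := by nlinarith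
    exact mul_le_mul_of_nonneg_left this (by positivity)
  have h2 : K * (S * (1 - p) - (1 + y) + y * (1 - p) * c) ≤ K * A :=
    mul_le_mul_of_nonneg_left (le_abs_self _) (by linarith)
  have h3 : 0 ≤ y * (1 - p) * (c * K - M) :=
    mul_nonneg (mul_nonneg hy.le (by linarith)) (by linarith)
  have h4 : (p * y + A) * K < p * (y * c ^ 2 - S) * K ^ 2 := by
    have : p * y + A < K * (p * (y * c ^ 2 - S)) := by rw [hk]; linarith
    nlinarith
  linarith

theorem envelope_antitone {y y₀ : ℝ} (hy : 0 < y) (hyy : y ≤ y₀) (hy₀ : y₀ ≤ 1) :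
    (1 + y₀) ^ 2 / (4 * y₀) ≤ (1 + y) ^ 2 / (4 * y) := by
  have h0 : 0 < y₀ := hy.trans_le hyy
  rw [div_le_div_iff₀ (by positivity) (by positivity)]
  have h : y * y₀ ≤ 1 := by nlinarith
  nlinarith [mul_nonneg (sub_nonneg.2 hyy) (sub_nonneg.2 h)]

theorem sInf_psiSup_of_le_quarter {p : ℝ} (hp0 : 0 < p) (hp : p ≤ 1 / 4) :
    sInf (psiSup p '' Set.Ioi 0) = 4 / 3 := by
  have hp1 : p ≤ 1 := by linarith
  refine sInf_psiSup_eq (y₀ := 1 / 3) hp0 hp1 (by norm_num) ?_ ?_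
  · intro k m hk
    rw [psiKM_le_iff hp0 hk]
    have hid : (4 / 3 : ℝ) * (k * (1 - p + p * k)) - (1 + 1 / 3) * (k * (1 + p * m))
        + 1 / 3 * (m * (1 - p + p * m))
        = (p * ((2 * k - m) * (2 * k - m - 2)) + m * (1 - 3 * p)) / 3 := by ring
    rw [hid]
    have hm : (0 : ℝ) ≤ m := Nat.cast_nonneg m
    rcases eq_or_ne (m + 1) (2 * k) with h | h
    · have h1 : (m : ℝ) + 1 = 2 * k := by exact_mod_cast h
      have h2 : (1 : ℝ) ≤ m := by exact_mod_cast (by omega : 1 ≤ m)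
      rw [← h1]
      nlinarith
    · have hd : (0 : ℤ) ≤ (2 * k - m) * (2 * k - m - 2) := by
        rcases (by omega : (2 * k - m : ℤ) ≤ 0 ∨ (2 : ℤ) ≤ 2 * k - m) with h' | h' <;> nlinarith
      have hd' : (0 : ℝ) ≤ (2 * k - m) * (2 * k - m - 2) := by exact_mod_cast hd
      have h3 : 0 ≤ 1 - 3 * p := by linarith
      positivity
  · intro y S hy h
    rcases le_total (1 / 3) y with hy' | hy'
    · have := (psiKM_le_iff hp0 le_rfl 0 y S).1 (h 1 0 le_rfl)
      norm_num at this
      linarith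
    · have h1 := envelope_le_of_psiKM_le hp0 hp1 hy h
      have h2 := envelope_antitone hy hy' (by norm_num)
      norm_num at h2
      linarith

theorem natCast_sub_one_mul_sub_two_nonneg (m : ℕ) : (0 : ℝ) ≤ ((m : ℝ) - 1) * (m - 2) := by
  have : (0 : ℤ) ≤ ((m : ℤ) - 1) * (m - 2) := by
    rcases (by omega : (m : ℤ) ≤ 1 ∨ (2 : ℤ) ≤ m) with h | h <;> nlinarith
  exact_mod_cast this

theorem sInf_psiSup_of_cubic_ge {p : ℝ} (hp0 : 0 < p) (hp1 : p ≤ 1)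
    (hp : 1 ≤ 8 * p ^ 3 + 4 * p ^ 2) :
    sInf (psiSup p '' Set.Ioi 0) = 1 + p + p ^ 2 / (1 + p) := by
  have hp37 : 37 / 100 ≤ p := by
    by_contra! hlt
    nlinarith [mul_pos hp0 hp0, mul_pos (mul_pos hp0 hp0) (sub_pos.2 hlt),
      mul_pos hp0 (sub_pos.2 hlt)]
  refine sInf_psiSup_eq (y₀ := p / (1 + p)) hp0 hp1 (by positivity) ?_ ?_
  · intro k m hk
    rw [psiKM_le_iff hp0 hk]
    have hid : (1 + p + p ^ 2 / (1 + p)) * (k * (1 - p + p * k))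
        - (1 + p / (1 + p)) * (k * (1 + p * m)) + p / (1 + p) * (m * (1 - p + p * m))
        = p / (1 + p) * ((1 + 2 * p + 2 * p ^ 2) * (k : ℝ) ^ 2 - (1 + 2 * p) * k * m + p * m ^ 2
          - (1 + 2 * p ^ 2) * k + (1 - p) * m) := by
      field_simp
      ring
    rw [hid]
    refine mul_nonneg (by positivity) ?_
    rcases eq_or_lt_of_le hk with rfl | hk2
    · have := mul_nonneg hp0.le (natCast_sub_one_mul_sub_two_nonneg m)
      push_cast
      linarith
    · have hK : (2 : ℝ) ≤ k := by exact_mod_cast hk2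
      generalize (k : ℝ) = K at *
      generalize (m : ℝ) = M at *
      have hdisc : 0 ≤ (8 * p ^ 3 + 4 * p ^ 2 - 1) * K ^ 2
          + (2 - 2 * p - 4 * p ^ 2 - 8 * p ^ 3) * K - (1 - p) ^ 2 := by
        have h1 : 0 ≤ 16 * p ^ 3 + 7 * p ^ 2 - 2 * p - 1 := by nlinarith
        have h2 : 0 ≤ 24 * p ^ 3 + 12 * p ^ 2 - 2 * p - 2 := by nlinarith
        nlinarith [mul_nonneg h2 (sub_nonneg.2 hK),
          mul_nonneg (sub_nonneg.2 hp) (sq_nonneg (K - 2))]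
      have hsq := sq_nonneg (2 * p * M - ((1 + 2 * p) * K - (1 - p)))
      refine nonneg_of_mul_nonneg_right (a := 4 * p) ?_ (by positivity)
      linarith
  · intro y S hy h
    have e : 1 + p + p ^ 2 / (1 + p) = 1 + p + p * (p / (1 + p)) := by ring
    have e' : p * (p / (1 + p)) = p - p / (1 + p) := by field_simp; ring
    rw [e]
    rcases le_total (p / (1 + p)) y with hy' | hy'
    · have := (psiKM_le_iff hp0 le_rfl 1 y S).1 (h 1 1 le_rfl)
      norm_num at this
      linarith [mul_le_mul_of_nonneg_left hy' hp0.le]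
    · have := (psiKM_le_iff hp0 le_rfl 2 y S).1 (h 1 2 le_rfl)
      norm_num at this
      linarith

theorem one_sub_sq_le_of_sq_eq {p c : ℝ} (hp0 : 0 < p) (hcc : c ^ 2 = 2 * (1 + p) * c - 1)
    (hc2 : 2 ≤ c) (hpc : 2 * p * c ≤ 1 + 2 * p) :
    (1 - p) ^ 2 ≤ 8 * p * (c * ((1 - p) * (c + 1) - 2)) := by
  have hq : 2 * p * c = (c - 1) ^ 2 := by linarith
  obtain ⟨t, rfl⟩ : ∃ t, c = 2 + t := ⟨c - 2, by ring⟩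
  have ht0 : 0 ≤ t := by linarith
  have hcubic : (1 + t) ^ 3 ≤ 2 + t := by nlinarith
  have ht1 : t ≤ 33 / 100 := by
    by_contra! hlt
    nlinarith [mul_pos (sub_pos.2 hlt) (sub_pos.2 hlt), pow_pos (sub_pos.2 hlt) 3]
  have hfac : 9 / 8 ≤ 2 + 3 * t - 7 * t ^ 2 - 25 * t ^ 3 - 9 * t ^ 4 := by
    nlinarith [mul_nonneg ht0 (sub_nonneg.2 ht1), mul_nonneg (pow_nonneg ht0 2) (sub_nonneg.2 ht1),
      mul_nonneg (pow_nonneg ht0 3) (sub_nonneg.2 ht1)]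
  have hexp : 2 + 7 * t + 9 * t ^ 2 ≤ (2 + t) * (1 + t) ^ 3 := by
    nlinarith [pow_nonneg ht0 3, pow_nonneg ht0 4]
  have hpos : 0 ≤ 1 - 2 * t - t ^ 2 := by nlinarith
  have hprod := mul_le_mul_of_nonneg_right hexp hpos
  have hsq : (3 - t ^ 2) ^ 2 ≤ 9 := by nlinarith
  have hscaled : (3 - t ^ 2) ^ 2 ≤ 8 * ((2 + t) * (1 + t) ^ 3 * (1 - 2 * t - t ^ 2)) := by linarith
  have hlhs : 4 * (2 + t) ^ 2 * (1 - p) ^ 2 = (3 - t ^ 2) ^ 2 := by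
    rw [show 4 * (2 + t) ^ 2 * (1 - p) ^ 2 = (2 * (2 + t) - 2 * p * (2 + t)) ^ 2 by ring, hq]
    ring
  have hrhs : 4 * (2 + t) ^ 2 * (8 * p * ((2 + t) * ((1 - p) * (2 + t + 1) - 2)))
      = 8 * ((2 + t) * (1 + t) ^ 3 * (1 - 2 * t - t ^ 2)) := by
    rw [show 4 * (2 + t) ^ 2 * (8 * p * ((2 + t) * ((1 - p) * (2 + t + 1) - 2)))
      = 8 * (2 * p * (2 + t)) * (2 + t)
        * ((2 * (2 + t) - 2 * p * (2 + t)) * (2 + t + 1) - 4 * (2 + t)) by ring, hq]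
    ring
  refine le_of_mul_le_mul_left ?_ (show 0 < 4 * (2 + t) ^ 2 by positivity)
  rw [hlhs, hrhs]
  exact hscaled

theorem sInf_psiSup_of_cubic_le {p : ℝ} (hp : 1 / 4 ≤ p) (hp' : 8 * p ^ 3 + 4 * p ^ 2 ≤ 1) :
    sInf (psiSup p '' Set.Ioi 0)
      = (1 + p + Real.sqrt (p * (2 + p))) / (1 - p + Real.sqrt (p * (2 + p))) := by
  have hp0 : 0 < p := by linarith
  have hp1 : p ≤ 1 := by nlinarith
  obtain ⟨c, hc⟩ : ∃ c, c = 1 + p + Real.sqrt (p * (2 + p)) := ⟨_, rfl⟩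
  have hs := Real.sq_sqrt (show 0 ≤ p * (2 + p) by positivity)
  have hs0 : 3 / 4 ≤ Real.sqrt (p * (2 + p)) := Real.le_sqrt_of_sq_le (by nlinarith)
  have hs1 : 2 * p * Real.sqrt (p * (2 + p)) ≤ 1 - 2 * p ^ 2 := by
    have hnn : 0 ≤ 1 - 2 * p ^ 2 := by nlinarith
    refine (pow_le_pow_iff_left₀ (by positivity) hnn two_ne_zero).1 ?_
    rw [mul_pow, hs]
    nlinarith
  have hcc : c ^ 2 = 2 * (1 + p) * c - 1 := by rw [hc]; linarith
  have hc2 : 2 ≤ c := by linarith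
  have hpc : 2 * p * c ≤ 1 + 2 * p := by rw [hc]; linarith
  have hB : (1 + p + Real.sqrt (p * (2 + p))) / (1 - p + Real.sqrt (p * (2 + p)))
      = c ^ 2 / (2 * c - 1) := by
    rw [← hc, show 1 - p + Real.sqrt (p * (2 + p)) = c - 2 * p by rw [hc]; ring,
      div_eq_div_iff (by linarith) (by linarith)]
    linear_combination (-c) * hcc
  rw [hB]
  clear hB hs hs0 hs1 hc
  have hd : 0 < 2 * c - 1 := by linarith
  have hone : 1 + 1 / (2 * c - 1) = 2 * c / (2 * c - 1) := by
    rw [eq_div_iff hd.ne', add_mul, div_mul_cancel₀ _ hd.ne']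
    ring
  refine sInf_psiSup_eq (y₀ := 1 / (2 * c - 1)) hp0 hp1 (by positivity) ?_ ?_
  · intro k m hk
    rw [psiKM_le_iff hp0 hk]
    have hid : c ^ 2 / (2 * c - 1) * (k * (1 - p + p * k))
        - (1 + 1 / (2 * c - 1)) * (k * (1 + p * m)) + 1 / (2 * c - 1) * (m * (1 - p + p * m))
        = (p * (m - c * k) ^ 2 + k * ((1 - p) * c ^ 2 - 2 * c) + m * (1 - p)) / (2 * c - 1) := by
      rw [hone]
      ring
    rw [hid]
    refine div_nonneg ?_ hd.le
    rcases eq_or_lt_of_le hk with rfl | hk2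
    · have h12 := mul_nonneg hp0.le (natCast_sub_one_mul_sub_two_nonneg m)
      push_cast
      rcases Nat.eq_zero_or_pos m with rfl | hm
      · push_cast
        nlinarith
      · have hm' : (1 : ℝ) ≤ m := by exact_mod_cast hm
        nlinarith [mul_nonneg (sub_nonneg.2 hm') (sub_nonneg.2 hpc)]
    · have hK : (2 : ℝ) ≤ k := by exact_mod_cast hk2
      generalize (k : ℝ) = K at *
      generalize (m : ℝ) = M at *
      have hdisc : (1 - p) ^ 2 ≤ 8 * p * (c * ((1 - p) * (c + 1) - 2)) :=
        one_sub_sq_le_of_sq_eq hp0 hcc hc2 hpc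
      have hpos : 0 ≤ 4 * p * (c * ((1 - p) * (c + 1) - 2)) := by nlinarith [sq_nonneg (1 - p)]
      have hsq := sq_nonneg (2 * p * (M - c * K) + (1 - p))
      refine nonneg_of_mul_nonneg_right (a := 4 * p) ?_ (by positivity)
      nlinarith [mul_nonneg hpos (sub_nonneg.2 hK)]
  · intro y S hy h
    rcases le_total (1 / (2 * c - 1)) y with hy' | hy'
    · have := (psiKM_le_iff hp0 le_rfl 1 y S).1 (h 1 1 le_rfl)
      norm_num at this
      have e : c ^ 2 / (2 * c - 1) = 1 + p + p * (1 / (2 * c - 1)) := by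
        rw [div_eq_iff hd.ne', add_mul, mul_assoc p, div_mul_cancel₀ _ hd.ne']
        linear_combination hcc
      linarith [mul_le_mul_of_nonneg_left hy' hp0.le]
    · have h1 := envelope_le_of_psiKM_le hp0 hp1 hy h
      have h2 := envelope_antitone hy hy' (by rw [div_le_one hd]; linarith)
      have e : (1 + 1 / (2 * c - 1)) ^ 2 / (4 * (1 / (2 * c - 1))) = c ^ 2 / (2 * c - 1) := by
        field_simp
        ring
      linarith

/-- For every `p ∈ (0,1]`, the infimum of `ψ_p` over `(0,∞)` equals `B(p)`,
where `B(p) = 4/3` if `p ≤ 1/4`,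
`B(p) = (1 + p + √(p(2+p)))/(1 − p + √(p(2+p)))` if `1/4 ≤ p` and `8p³+4p² ≤ 1`,
and `B(p) = 1 + p + p²/(1+p)` if `8p³+4p² ≥ 1`. -/
theorem psi_inf_eq_poa (p : ℝ) (hp0 : 0 < p) (hp1 : p ≤ 1) :
    (p ≤ 1 / 4 → sInf (psiSup p '' Set.Ioi 0) = 4 / 3)
    ∧ (1 / 4 ≤ p → 8 * p ^ 3 + 4 * p ^ 2 ≤ 1 →
        sInf (psiSup p '' Set.Ioi 0)
          = (1 + p + Real.sqrt (p * (2 + p))) / (1 - p + Real.sqrt (p * (2 + p))))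
    ∧ (1 ≤ 8 * p ^ 3 + 4 * p ^ 2 →
        sInf (psiSup p '' Set.Ioi 0) = 1 + p + p ^ 2 / (1 + p)) := by
  exact ⟨sInf_psiSup_of_le_quarter hp0, sInf_psiSup_of_cubic_le, sInf_psiSup_of_cubic_ge hp0 hp1⟩
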